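/- If T is a tree with n ≥ 1 vertices (a connected finite simple graph with no cycles), then C(T) = 2^(n-1). -/

import Mathlib

theorem Finpartition.mem_parts_iff_exists_part {α : Type*} [DecidableEq α] {s : Finset α}
    (P : Finpartition s) {b : Finset α} : b ∈ P.parts ↔ ∃ a ∈ s, P.part a = b := by
  constructor
  · intro hb
    obtain ⟨a, ha⟩ := P.nonempty_of_mem_parts hb
    exact ⟨a, P.le hb ha, P.part_eq_of_mem hb ha⟩
  · rintro ⟨a, ha, rfl⟩
    exact P.part_mem.2 ha

theorem Finpartition.ext_part {α : Type*} [DecidableEq α] {s : Finset α} {P Q : Finpartition s}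
    (h : ∀ a ∈ s, P.part a = Q.part a) : P = Q := by
  ext b
  rw [P.mem_parts_iff_exists_part, Q.mem_parts_iff_exists_part]
  exact exists_congr fun a ↦ and_congr_right fun ha ↦ by rw [h a ha]

namespace SimpleGraph

variable {V : Type*}

/-- The spanning subgraphs of `G` correspond to the sets of edges of `G`. -/
def spanningSubgraphEquiv (G : SimpleGraph V) : {H : SimpleGraph V // H ≤ G} ≃ Set G.edgeSet where
  toFun H := {e | e.1 ∈ H.1.edgeSet}
  invFun S := ⟨fromEdgeSet (Subtype.val '' S), fun u v h ↦ by
    obtain ⟨⟨e, -, he⟩, -⟩ := h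
    rw [← mem_edgeSet, ← he]
    exact e.2⟩
  left_inv H := by
    ext u v
    simp only [fromEdgeSet_adj, Set.mem_image, Set.mem_ofPred_eq, Subtype.exists, exists_and_left,
      exists_prop]
    constructor
    · rintro ⟨⟨e, he, -, rfl⟩, -⟩
      exact he
    · exact fun h ↦ ⟨⟨_, h, H.2 h, rfl⟩, h.ne⟩
  right_inv S := by
    ext ⟨e, he⟩
    simp only [edgeSet_fromEdgeSet, Set.mem_ofPred_eq, Set.mem_sdiff, Set.mem_image]
    constructor
    · rintro ⟨⟨e', he', rfl⟩, -⟩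
      exact he'
    · exact fun h ↦ ⟨⟨_, h, rfl⟩, G.not_isDiag_of_mem_edgeSet he⟩

theorem IsAcyclic.adj_of_le_of_reachable {G H : SimpleGraph V} (hG : G.IsAcyclic) (hle : H ≤ G)
    {u v : V} (hadj : G.Adj u v) (h : H.Reachable u v) : H.Adj u v := by
  by_contra hn
  refine isBridge_iff.1 (isAcyclic_iff_forall_adj_isBridge.1 hG hadj) (h.mono fun a b hab ↦ ?_)
  rw [deleteEdges_adj]
  refine ⟨hle hab, fun he ↦ hn ?_⟩
  rw [← mem_edgeSet] at hab ⊢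
  rwa [← Set.mem_singleton_iff.1 he]

section Finpartition

variable [Fintype V] [DecidableEq V]

/-- The partition of the vertices of `H` into connected components. -/
noncomputable def componentPartition (H : SimpleGraph V) :
    Finpartition (Finset.univ : Finset V) :=
  letI : DecidableRel H.reachableSetoid := Classical.decRel _
  Finpartition.ofSetoid H.reachableSetoid

theorem mem_part_componentPartition {H : SimpleGraph V} {u v : V} :
    v ∈ H.componentPartition.part u ↔ H.Reachable u v :=
  letI : DecidableRel H.reachableSetoid := Classical.decRel _
  Finpartition.mem_part_ofSetoid_iff_rel

theorem connected_induce_of_mem_componentPartition {H : SimpleGraph V} {b : Finset V}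
    (hb : b ∈ H.componentPartition.parts) : (H.induce (b : Set V)).Connected := by
  obtain ⟨a, -, rfl⟩ := (Finpartition.mem_parts_iff_exists_part _).1 hb
  have : (H.componentPartition.part a : Set V) = (H.connectedComponentMk a).supp := by
    ext v
    rw [Finset.mem_coe, mem_part_componentPartition, ConnectedComponent.mem_supp_iff,
      ConnectedComponent.eq, reachable_comm]
  rw [this]
  exact (H.connectedComponentMk a).connected_toSimpleGraph

/-- The spanning subgraph of `G` whose edges join vertices in the same block of `P`. -/
def blockGraph (G : SimpleGraph V) (P : Finpartition (Finset.univ : Finset V)) :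
    SimpleGraph V where
  Adj u v := G.Adj u v ∧ P.part u = P.part v
  symm := ⟨fun _ _ h ↦ ⟨h.1.symm, h.2.symm⟩⟩
  loopless := ⟨fun _ h ↦ h.1.ne rfl⟩

theorem componentPartition_blockGraph {G : SimpleGraph V}
    {P : Finpartition (Finset.univ : Finset V)}
    (hP : ∀ b ∈ P.parts, (G.induce (b : Set V)).Connected) :
    (G.blockGraph P).componentPartition = P := by
  refine Finpartition.ext_part fun u _ ↦ ?_
  ext v
  rw [mem_part_componentPartition]
  constructor
  · rintro ⟨w⟩
    have h : P.part u = P.part v := by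
      induction w with
      | nil => rfl
      | cons h _ ih => exact h.2.trans (ih (Finset.mem_univ _))
    exact h ▸ P.mem_part (Finset.mem_univ v)
  · intro hv
    have hu : u ∈ P.part u := P.mem_part (Finset.mem_univ u)
    have hmem : P.part u ∈ P.parts := P.part_mem.2 (Finset.mem_univ u)
    let f : G.induce (P.part u : Set V) →g G.blockGraph P :=
      { toFun := Subtype.val
        map_rel' := fun {a b} hab ↦
          ⟨hab, (P.part_eq_of_mem hmem a.2).trans (P.part_eq_of_mem hmem b.2).symm⟩ }
    exact ((hP _ hmem).preconnected ⟨u, hu⟩ ⟨v, hv⟩).map f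

/-- Compositions of an acyclic graph correspond to its spanning subgraphs: a composition is the
partition into connected components of exactly one of them. -/
noncomputable def IsAcyclic.compositionEquiv {G : SimpleGraph V} (hG : G.IsAcyclic) :
    {P : Finpartition (Finset.univ : Finset V) //
      ∀ b ∈ P.parts, (G.induce (b : Set V)).Connected} ≃ {H : SimpleGraph V // H ≤ G} where
  toFun P := ⟨G.blockGraph P.1, fun _ _ h ↦ h.1⟩
  invFun H := ⟨H.1.componentPartition, fun _ hb ↦
    (connected_induce_of_mem_componentPartition hb).mono fun _ _ h ↦ H.2 h⟩
  left_inv P := Subtype.ext (componentPartition_blockGraph P.2)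
  right_inv H := by
    ext u v
    have key : H.1.componentPartition.part u = H.1.componentPartition.part v ↔
        H.1.Reachable u v := by
      rw [← mem_part_componentPartition, Finpartition.mem_part_iff_part_eq_part _
        (Finset.mem_univ _) (Finset.mem_univ _), eq_comm]
    change G.Adj u v ∧ _ ↔ _
    rw [key]
    exact ⟨fun h ↦ hG.adj_of_le_of_reachable H.2 h.1 h.2, fun h ↦ ⟨H.2 h, h.reachable⟩⟩

end Finpartition

end SimpleGraph


/-- A composition of a graph `G` is a partition of its vertex set into (nonempty) blocks,
each of which induces a connected subgraph of `G`.  `numComp G` is the number of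
compositions of `G`. -/
noncomputable def numComp {V : Type*} [Fintype V] [DecidableEq V] (G : SimpleGraph V) : ℕ :=
  Nat.card {P : Finpartition (Finset.univ : Finset V) //
    ∀ b ∈ P.parts, (G.induce (b : Set V)).Connected}

/-- If `T` is a tree (a connected acyclic graph) on `n ≥ 1` vertices, then
`C(T) = 2^(n-1)`. -/
theorem numComp_tree {V : Type*} [Fintype V] [DecidableEq V] (T : SimpleGraph V)
    (hT : T.IsTree) (n : ℕ) (hn : 1 ≤ n) (hcard : Fintype.card V = n) :
    numComp T = 2 ^ (n - 1) := by
  classical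
  have hedges := hT.card_edgeFinset
  rw [numComp, Nat.card_congr (hT.isAcyclic.compositionEquiv.trans T.spanningSubgraphEquiv),
    Nat.card_eq_fintype_card, Fintype.card_set, ← SimpleGraph.edgeFinset_card]
  congr 1
  omega
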